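/- Let f : ℝ → ℝ be infinitely differentiable, let x ∈ ℝ be a critical point of order 1 (f′(x) = 0 and f″(x) ≠ 0), and let p ≥ 1 be a real exponent. With (C₀, C₁, C₂) = (−13/6, 0, 13/6) and (D₀, D₁, D₂) = (−15/2, −19/3, −19/6), the WENO-ZC+ weights are well defined for all sufficiently small Δx > 0 and satisfy, for each k ∈ {0,1,2}, ω_k^{ZC+,+}(x,Δx) = d_k·[1 + (6/13)·(C_k − 13/30)·(f‴(x)/f″(x))·Δx + O(Δx²)] and ω_k^{ZC+,−}(x,Δx) = d_k·[1 + (6/25)·(D_k + 11/2)·(f‴(x)/f″(x))·Δx + O(Δx²)] as Δx → 0⁺; in particular, if f‴(x) ≠ 0 then for k = 0 and k = 2 the deviation ω_k^{ZC+,+} − d_k is of exact order Δx, so the WENO-ZC+ weights do not satisfy the O(Δx³) condition required for fifth-order accuracy at first-order critical points. -/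

import Mathlib

/-- The Jiang--Shu smoothness indicators `β₀, β₁, β₂`; the right-boundary
indicators are `wenoBeta f x Δx k` and the left-boundary ones are
`wenoBeta f (x - Δx) Δx k`. -/
noncomputable def wenoBeta (f : ℝ → ℝ) (x Δx : ℝ) : Fin 3 → ℝ
  | 0 => (1 / 4) * (f (x - 2 * Δx) - 4 * f (x - Δx) + 3 * f x) ^ 2
       + (13 / 12) * (f (x - 2 * Δx) - 2 * f (x - Δx) + f x) ^ 2
  | 1 => (1 / 4) * (f (x + Δx) - f (x - Δx)) ^ 2
       + (13 / 12) * (f (x - Δx) - 2 * f x + f (x + Δx)) ^ 2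
  | 2 => (1 / 4) * (3 * f x - 4 * f (x + Δx) + f (x + 2 * Δx)) ^ 2
       + (13 / 12) * (f x - 2 * f (x + Δx) + f (x + 2 * Δx)) ^ 2

/-- The global smoothness indicator `τ(x,Δx) = |β₂(x,Δx) − β₀(x,Δx)|`. -/
noncomputable def wenoTau (f : ℝ → ℝ) (x Δx : ℝ) : ℝ :=
  |wenoBeta f x Δx 2 - wenoBeta f x Δx 0|

/-- The mean smoothness indicator `β̄(x,Δx) = (β₀ + β₁ + β₂)/3`. -/
noncomputable def wenoBetaBar (f : ℝ → ℝ) (x Δx : ℝ) : ℝ :=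
  (wenoBeta f x Δx 0 + wenoBeta f x Δx 1 + wenoBeta f x Δx 2) / 3

/-- The ideal weights `(d₀, d₁, d₂) = (1/10, 6/10, 3/10)`. -/
noncomputable def wenoD : Fin 3 → ℝ
  | 0 => 1 / 10
  | 1 => 6 / 10
  | 2 => 3 / 10

/-- The centering coefficients `(c₀, c₁, c₂) = (3/4, 3/2, 3/4)`. -/
noncomputable def wenoCk : Fin 3 → ℝ
  | 0 => 3 / 4
  | 1 => 3 / 2
  | 2 => 3 / 4

/-- The coefficients `(C₀, C₁, C₂) = (−13/6, 0, 13/6)`. -/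
noncomputable def wenoCC : Fin 3 → ℝ
  | 0 => -13 / 6
  | 1 => 0
  | 2 => 13 / 6

/-- The coefficients `(D₀, D₁, D₂) = (−15/2, −19/3, −19/6)`. -/
noncomputable def wenoDD : Fin 3 → ℝ
  | 0 => -15 / 2
  | 1 => -19 / 3
  | 2 => -19 / 6

/-- The unnormalized WENO-ZC+ weights (with `ε = 0` and real exponent `p`):
`α_k^{ZC+} = d_k·[1 + c_k·(τ/β_k)^p·(τ/(τ + β̄))^p + β_k/(τ + β̄)]`. -/
noncomputable def alphaZCPlus (p : ℝ) (f : ℝ → ℝ) (x Δx : ℝ) (k : Fin 3) : ℝ :=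
  wenoD k * (1 + wenoCk k * (wenoTau f x Δx / wenoBeta f x Δx k) ^ p *
      (wenoTau f x Δx / (wenoTau f x Δx + wenoBetaBar f x Δx)) ^ p
    + wenoBeta f x Δx k / (wenoTau f x Δx + wenoBetaBar f x Δx))

/-- The normalized WENO-ZC+ weights. -/
noncomputable def omegaZCPlus (p : ℝ) (f : ℝ → ℝ) (x Δx : ℝ) (k : Fin 3) : ℝ :=
  alphaZCPlus p f x Δx k / (∑ j : Fin 3, alphaZCPlus p f x Δx j)

open Filter Topology Asymptotics in
/-- First-order expansion with quadratic remainder. -/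
def WExp (u : ℝ → ℝ) (c d : ℝ) : Prop :=
  (fun h => u h - (c + d * h)) =O[𝓝[>] (0:ℝ)] (fun h => h ^ 2)

open Filter Topology Asymptotics

theorem wsq_one : (fun h : ℝ => h ^ 2) =O[𝓝[>] (0:ℝ)] (fun _ => (1:ℝ)) := by
  have : Tendsto (fun h : ℝ => h ^ 2) (𝓝[>] (0:ℝ)) (𝓝 (0 ^ 2)) :=
    ((continuous_pow 2).tendsto 0).mono_left nhdsWithin_le_nhds
  exact this.isBigO_one ℝ

theorem wlin_tendsto (c d : ℝ) : Tendsto (fun h : ℝ => c + d * h) (𝓝[>] (0:ℝ)) (𝓝 c) := by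
  have : Tendsto (fun h : ℝ => c + d * h) (𝓝 (0:ℝ)) (𝓝 (c + d * 0)) :=
    (by fun_prop : Continuous (fun h : ℝ => c + d * h)).tendsto 0
  simp only [mul_zero, add_zero] at this
  exact this.mono_left nhdsWithin_le_nhds

theorem WExp.tendsto {u : ℝ → ℝ} {c d : ℝ} (hu : WExp u c d) :
    Tendsto u (𝓝[>] (0:ℝ)) (𝓝 c) := by
  have h0 : Tendsto (fun h : ℝ => h ^ 2) (𝓝[>] (0:ℝ)) (𝓝 0) := by
    have : Tendsto (fun h : ℝ => h ^ 2) (𝓝[>] (0:ℝ)) (𝓝 (0 ^ 2)) :=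
      ((continuous_pow 2).tendsto 0).mono_left nhdsWithin_le_nhds
    simpa using this
  have h1 := IsBigO.trans_tendsto hu h0
  have := h1.add (wlin_tendsto c d)
  simpa using this

theorem WExp.congr {u v : ℝ → ℝ} {c d c' d' : ℝ} (hu : WExp u c d)
    (h : ∀ᶠ t in 𝓝[>] (0:ℝ), u t = v t) (hc : c = c') (hd : d = d') : WExp v c' d' := by
  subst hc hd
  refine IsBigO.congr' hu ?_ (EventuallyEq.refl _ _)
  filter_upwards [h] with t ht
  rw [ht]

theorem WExp.const (c : ℝ) : WExp (fun _ => c) c 0 := by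
  have : (fun h : ℝ => c - (c + 0 * h)) = fun _ => 0 := by funext h; ring
  unfold WExp
  rw [this]
  exact isBigO_zero _ _

theorem WExp.add {u v : ℝ → ℝ} {c d c' d' : ℝ} (hu : WExp u c d) (hv : WExp v c' d') :
    WExp (fun h => u h + v h) (c + c') (d + d') := by
  refine (IsBigO.add hu hv).congr_left ?_
  intro h; ring

theorem WExp.smul {u : ℝ → ℝ} {c d : ℝ} (r : ℝ) (hu : WExp u c d) :
    WExp (fun h => r * u h) (r * c) (r * d) := by
  refine (IsBigO.const_mul_left hu r).congr_left ?_
  intro h; ring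

theorem WExp.sub {u v : ℝ → ℝ} {c d c' d' : ℝ} (hu : WExp u c d) (hv : WExp v c' d') :
    WExp (fun h => u h - v h) (c - c') (d - d') := by
  refine (IsBigO.sub hu hv).congr_left ?_
  intro h; ring

theorem WExp.mul {u v : ℝ → ℝ} {c d c' d' : ℝ} (hu : WExp u c d) (hv : WExp v c' d') :
    WExp (fun h => u h * v h) (c * c') (c * d' + d * c') := by
  have hv1 := hv.tendsto.isBigO_one ℝ
  have hl1 := (wlin_tendsto c d).isBigO_one ℝ
  have e1 : (fun h => (u h - (c + d * h)) * v h) =O[𝓝[>] (0:ℝ)] (fun h => h ^ 2) := by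
    simpa using IsBigO.mul hu hv1
  have e2 : (fun h => (c + d * h) * (v h - (c' + d' * h))) =O[𝓝[>] (0:ℝ)] (fun h => h ^ 2) := by
    simpa using IsBigO.mul hl1 hv
  have e3 : (fun h : ℝ => (d * d') * h ^ 2) =O[𝓝[>] (0:ℝ)] (fun h => h ^ 2) :=
    (isBigO_refl _ _).const_mul_left _
  refine ((e1.add e2).add e3).congr_left ?_
  intro h; ring

theorem WExp.inv {u : ℝ → ℝ} {c d : ℝ} (hu : WExp u c d) (hc : c ≠ 0) :
    WExp (fun h => (u h)⁻¹) c⁻¹ (-d / c ^ 2) := by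
  have hi := (hu.tendsto.inv₀ hc).isBigO_one ℝ
  have hw : WExp (fun h => c⁻¹ + (-d / c ^ 2) * h) c⁻¹ (-d / c ^ 2) := by
    have : (fun h : ℝ => (c⁻¹ + (-d / c ^ 2) * h) - (c⁻¹ + (-d / c ^ 2) * h)) = fun _ => 0 := by
      funext h; ring
    unfold WExp
    rw [this]
    exact isBigO_zero _ _
  have hm : WExp _ 1 0 := (hu.mul hw).congr (Eventually.of_forall fun _ => rfl)
    (by field_simp) (by field_simp; ring)
  have e : (fun h => (u h)⁻¹ * (u h * (c⁻¹ + (-d / c ^ 2) * h) - (1 + 0 * h)))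
      =O[𝓝[>] (0:ℝ)] (fun h => h ^ 2) := by
    simpa using IsBigO.mul hi hm
  refine e.neg_left.congr' ?_ (EventuallyEq.refl _ _)
  filter_upwards [hu.tendsto.eventually_ne hc] with h hh
  field_simp
  ring

theorem WExp.div {u v : ℝ → ℝ} {c d c' d' : ℝ} (hu : WExp u c d) (hv : WExp v c' d')
    (hc : c' ≠ 0) :
    WExp (fun h => u h / v h) (c / c') (d / c' - c * d' / c' ^ 2) := by
  refine (hu.mul (hv.inv hc)).congr (Eventually.of_forall fun h => ?_) ?_ ?_
  · exact (div_eq_mul_inv _ _).symm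
  · exact (div_eq_mul_inv _ _).symm
  · field_simp; ring

theorem WExp.abs {u : ℝ → ℝ} {d : ℝ} (hu : WExp u 0 d) : WExp (fun h => |u h|) 0 |d| := by
  refine IsBigO.trans (IsBigO.of_bound 1 ?_) hu
  filter_upwards [self_mem_nhdsWithin] with h hh
  have hh : 0 < h := hh
  have : |d| * h = |d * h| := by rw [abs_mul, abs_of_pos hh]
  simp only [Real.norm_eq_abs, zero_add, one_mul, this]
  exact abs_abs_sub_abs_le _ _

/-- generic weights -/
noncomputable def wAl (p : ℝ) (β : Fin 3 → ℝ) (k : Fin 3) : ℝ :=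
  wenoD k * (1 + wenoCk k * (|β 2 - β 0| / β k) ^ p *
      (|β 2 - β 0| / (|β 2 - β 0| + (β 0 + β 1 + β 2) / 3)) ^ p
    + β k / (|β 2 - β 0| + (β 0 + β 1 + β 2) / 3))

theorem wAl_scale (p s : ℝ) (hs : 0 < s) (β b : Fin 3 → ℝ) (h : ∀ k, β k = s * b k) (k : Fin 3) :
    wAl p β k = wAl p b k := by
  have e1 : |β 2 - β 0| = s * |b 2 - b 0| := by
    rw [h, h, ← mul_sub, abs_mul, abs_of_pos hs]
  have e2 : s * |b 2 - b 0| + (s * b 0 + s * b 1 + s * b 2) / 3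
      = s * (|b 2 - b 0| + (b 0 + b 1 + b 2) / 3) := by ring
  unfold wAl
  rw [e1]
  simp only [h]
  rw [e2, mul_div_mul_left _ _ hs.ne', mul_div_mul_left _ _ hs.ne', mul_div_mul_left _ _ hs.ne']

/-- core expansion -/
theorem wcore (p : ℝ) (hp : 1 ≤ p) (b : ℝ → Fin 3 → ℝ) (A : ℝ) (hA : 0 < A) (B : Fin 3 → ℝ)
    (hb : ∀ k, WExp (fun h => b h k) A (B k)) :
    (∀ᶠ h in 𝓝[>] (0:ℝ), (∀ k, 0 < b h k) ∧ 0 < ∑ j, wAl p (b h) j) ∧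
    ∀ k, WExp (fun h => wAl p (b h) k / ∑ j, wAl p (b h) j) (wenoD k)
      (wenoD k * ((B k - (1/10 * B 0 + 6/10 * B 1 + 3/10 * B 2)) / (2 * A))) := by
  have hpos : ∀ᶠ h in 𝓝[>] (0:ℝ), ∀ k, 0 < b h k := by
    rw [eventually_all]
    intro k
    exact (hb k).tendsto.eventually_const_lt hA
  have hT : WExp (fun h => |b h 2 - b h 0|) 0 |B 2 - B 0| :=
    (((hb 2).sub (hb 0)).congr (Eventually.of_forall fun _ => rfl) (sub_self A) rfl).abs
  have hS : WExp (fun h => |b h 2 - b h 0| + (b h 0 + b h 1 + b h 2) / 3) A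
      (|B 2 - B 0| + (B 0 + B 1 + B 2) / 3) := by
    refine (hT.add ((((hb 0).add (hb 1)).add (hb 2)).smul (1/3))).congr
      (Eventually.of_forall fun h => ?_) ?_ ?_
    · ring
    · ring
    · ring
  have hv : ∀ k, WExp (fun h => wenoCk k * (|b h 2 - b h 0| / b h k) ^ p *
      (|b h 2 - b h 0| / (|b h 2 - b h 0| + (b h 0 + b h 1 + b h 2) / 3)) ^ p) 0 0 := by
    intro k
    have q1 := hT.div (hb k) hA.ne'
    have q2 := hT.div hS hA.ne'
    have q3 : WExp _ 0 0 := ((q1.mul q2).smul (wenoCk k)).congr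
      (Eventually.of_forall fun _ => rfl) (by simp) (by simp)
    refine IsBigO.trans (IsBigO.of_bound 1 ?_) q3
    have l1 : ∀ᶠ h in 𝓝[>] (0:ℝ), |b h 2 - b h 0| / b h k < 1 :=
      q1.tendsto.eventually_lt_const (by simp)
    have l2 : ∀ᶠ h in 𝓝[>] (0:ℝ),
        |b h 2 - b h 0| / (|b h 2 - b h 0| + (b h 0 + b h 1 + b h 2) / 3) < 1 :=
      q2.tendsto.eventually_lt_const (by simp)
    filter_upwards [hpos, l1, l2] with h hh a1 a2
    have n1 : 0 ≤ |b h 2 - b h 0| / b h k := div_nonneg (abs_nonneg _) (hh k).le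
    have n2 : 0 ≤ |b h 2 - b h 0| / (|b h 2 - b h 0| + (b h 0 + b h 1 + b h 2) / 3) := by
      have := hh 0; have := hh 1; have := hh 2
      positivity
    have hck : 0 ≤ wenoCk k := by fin_cases k <;> norm_num [wenoCk]
    generalize |b h 2 - b h 0| / (|b h 2 - b h 0| + (b h 0 + b h 1 + b h 2) / 3) = t2 at *
    generalize |b h 2 - b h 0| / b h k = t1 at *
    have r1 : t1 ^ p ≤ t1 := by
      simpa using Real.rpow_le_rpow_of_exponent_ge' n1 a1.le zero_le_one hp
    have r2 : t2 ^ p ≤ t2 := by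
      simpa using Real.rpow_le_rpow_of_exponent_ge' n2 a2.le zero_le_one hp
    have s1 := Real.rpow_nonneg n1 p
    have s2 := Real.rpow_nonneg n2 p
    have m : t1 ^ p * t2 ^ p ≤ t1 * t2 := mul_le_mul r1 r2 s2 n1
    simp only [zero_mul, add_zero, sub_zero, one_mul, Real.norm_eq_abs, mul_assoc]
    rw [abs_of_nonneg (by positivity), abs_of_nonneg (by positivity)]
    exact mul_le_mul_of_nonneg_left m hck
  have hal : ∀ k, WExp (fun h => wAl p (b h) k) (2 * wenoD k)
      (wenoD k * (B k / A - (|B 2 - B 0| + (B 0 + B 1 + B 2) / 3) / A)) := by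
    intro k
    refine ((((WExp.const 1).add (hv k)).add ((hb k).div hS hA.ne')).smul (wenoD k)).congr
      (Eventually.of_forall fun h => rfl) ?_ ?_
    · rw [div_self hA.ne']; ring
    · field_simp; ring
  have hsum : WExp (fun h => ∑ j, wAl p (b h) j) 2
      ((1/10 * B 0 + 6/10 * B 1 + 3/10 * B 2) / A
        - (|B 2 - B 0| + (B 0 + B 1 + B 2) / 3) / A) := by
    refine (((hal 0).add (hal 1)).add (hal 2)).congr (Eventually.of_forall fun h => ?_) ?_ ?_
    · exact (Fin.sum_univ_three _).symm
    · norm_num [wenoD]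
    · simp only [wenoD]; ring
  refine ⟨hpos.and (hsum.tendsto.eventually_const_lt (by norm_num)), fun k => ?_⟩
  refine ((hal k).div hsum (by norm_num)).congr (Eventually.of_forall fun h => rfl) ?_ ?_
  · ring
  · field_simp; ring

theorem wtaylor (f : ℝ → ℝ) (hf : ContDiff ℝ (⊤ : ℕ∞) f) (x : ℝ) (h1 : deriv f x = 0) (c : ℝ) :
    WExp (fun h => (f (x + c * h) - f x) / h ^ 2)
      (iteratedDeriv 2 f x / 2 * c ^ 2) (iteratedDeriv 3 f x / 6 * c ^ 3) := by
  have h4 : ContDiff ℝ (4 : ℕ) f := contDiff_infty.1 hf 4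
  have ht := (taylor_isLittleO_univ (x₀ := x) h4).isBigO
  have hc : Tendsto (fun h : ℝ => x + c * h) (𝓝[>] (0:ℝ)) (𝓝 x) := wlin_tendsto x c
  have h5 := ht.comp_tendsto hc
  have h6 : (fun h : ℝ => (x + c * h - x) ^ 4) =O[𝓝[>] (0:ℝ)] (fun h : ℝ => h ^ 4) := by
    refine ((isBigO_refl (fun h : ℝ => h ^ 4) _).const_mul_left (c ^ 4)).congr_left ?_
    intro h; ring
  have h7 : (fun h : ℝ => (iteratedDeriv 4 f x / 24 * c ^ 4) * h ^ 4)
      =O[𝓝[>] (0:ℝ)] (fun h : ℝ => h ^ 4) := (isBigO_refl _ _).const_mul_left _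
  have h8 := (h5.trans h6).add h7
  have h9 : (fun h : ℝ => (h ^ 2)⁻¹) =O[𝓝[>] (0:ℝ)] (fun h : ℝ => (h ^ 2)⁻¹) := isBigO_refl _ _
  refine (h8.mul h9).congr' ?_ ?_
  · filter_upwards [self_mem_nhdsWithin] with h hh
    have hh : h ≠ 0 := ne_of_gt hh
    simp only [Function.comp, taylorWithinEval_succ, taylor_within_zero_eval,
      iteratedDerivWithin_univ]
    norm_num [Nat.factorial, h1]
    field_simp
    ring
  · filter_upwards [self_mem_nhdsWithin] with h hh
    have hh : h ≠ 0 := ne_of_gt hh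
    field_simp

theorem wquad {u v : ℝ → ℝ} {c d c' d' : ℝ} (hu : WExp u c d) (hv : WExp v c' d') :
    WExp (fun h => (1/4) * (u h) ^ 2 + (13/12) * (v h) ^ 2)
      ((1/4) * c ^ 2 + (13/12) * c' ^ 2) ((1/2) * c * d + (13/6) * c' * d') := by
  refine (((hu.mul hu).smul (1/4)).add ((hv.mul hv).smul (13/12))).congr
    (Eventually.of_forall fun h => ?_) ?_ ?_ <;> ring

theorem wright (f : ℝ → ℝ) (hf : ContDiff ℝ (⊤ : ℕ∞) f) (x : ℝ) (h1 : deriv f x = 0) (k : Fin 3) :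
    WExp (fun h => wenoBeta f x h k / h ^ 4) (13/12 * iteratedDeriv 2 f x ^ 2)
      (wenoCC k * (iteratedDeriv 2 f x * iteratedDeriv 3 f x)) := by
  have T := wtaylor f hf x h1
  fin_cases k
  · refine (wquad ((T (-2)).sub ((T (-1)).smul 4)) ((T (-2)).sub ((T (-1)).smul 2))).congr ?_ ?_ ?_
    · filter_upwards [self_mem_nhdsWithin] with h hh
      have hh : h ≠ 0 := ne_of_gt hh
      have e1 : x - 2 * h = x + -2 * h := by ring
      have e2 : x - h = x + -1 * h := by ring
      simp only [wenoBeta, e1, e2]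
      field_simp
      ring
    · ring
    · simp only [wenoCC]; ring
  · refine (wquad ((T 1).sub (T (-1))) ((T 1).add (T (-1)))).congr ?_ ?_ ?_
    · filter_upwards [self_mem_nhdsWithin] with h hh
      have hh : h ≠ 0 := ne_of_gt hh
      have e1 : x + h = x + 1 * h := by ring
      have e2 : x - h = x + -1 * h := by ring
      simp only [wenoBeta, e1, e2]
      field_simp
      ring
    · ring
    · simp only [wenoCC]; ring
  · refine (wquad ((T 2).sub ((T 1).smul 4)) ((T 2).sub ((T 1).smul 2))).congr ?_ ?_ ?_
    · filter_upwards [self_mem_nhdsWithin] with h hh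
      have hh : h ≠ 0 := ne_of_gt hh
      have e2 : x + h = x + 1 * h := by ring
      simp only [wenoBeta, e2]
      field_simp
      ring
    · ring
    · simp only [wenoCC]; ring

theorem wleft (f : ℝ → ℝ) (hf : ContDiff ℝ (⊤ : ℕ∞) f) (x : ℝ) (h1 : deriv f x = 0) (k : Fin 3) :
    WExp (fun h => wenoBeta f (x - h) h k / h ^ 4) (25/12 * iteratedDeriv 2 f x ^ 2)
      ((wenoDD k + 17/6) * (iteratedDeriv 2 f x * iteratedDeriv 3 f x)) := by
  have T := wtaylor f hf x h1
  fin_cases k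
  · refine (wquad (((T (-3)).sub ((T (-2)).smul 4)).add ((T (-1)).smul 3))
      (((T (-3)).sub ((T (-2)).smul 2)).add (T (-1)))).congr ?_ ?_ ?_
    · filter_upwards [self_mem_nhdsWithin] with h hh
      have hh : h ≠ 0 := ne_of_gt hh
      have e1 : x - h - 2 * h = x + -3 * h := by ring
      have e2 : x - h - h = x + -2 * h := by ring
      have e3 : x - h = x + -1 * h := by ring
      simp only [wenoBeta, e1, e2]
      simp only [e3]
      field_simp
      ring
    · ring
    · simp only [wenoDD]; ring
  · refine (wquad (T (-2)) ((T (-2)).sub ((T (-1)).smul 2))).congr ?_ ?_ ?_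
    · filter_upwards [self_mem_nhdsWithin] with h hh
      have hh : h ≠ 0 := ne_of_gt hh
      have e1 : x - h + h = x := by ring
      have e2 : x - h - h = x + -2 * h := by ring
      have e3 : x - h = x + -1 * h := by ring
      simp only [wenoBeta, e1, e2]
      simp only [e3]
      field_simp
      ring
    · ring
    · simp only [wenoDD]; ring
  · refine (wquad (((T (-1)).smul 3).add (T 1)) ((T (-1)).add (T 1))).congr ?_ ?_ ?_
    · filter_upwards [self_mem_nhdsWithin] with h hh
      have hh : h ≠ 0 := ne_of_gt hh
      have e1 : x - h + 2 * h = x + 1 * h := by ring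
      have e2 : x - h + h = x := by ring
      have e3 : x - h = x + -1 * h := by ring
      simp only [wenoBeta, e1, e2]
      simp only [e3]
      field_simp
      ring
    · ring
    · simp only [wenoDD]; ring

/-- transfer to the actual weights; `y h` is the evaluation point -/
theorem wmain (p : ℝ) (hp : 1 ≤ p) (f : ℝ → ℝ) (y : ℝ → ℝ) (A : ℝ) (hA : 0 < A) (B : Fin 3 → ℝ)
    (hb : ∀ k, WExp (fun h => wenoBeta f (y h) h k / h ^ 4) A (B k)) :
    (∀ᶠ h in 𝓝[>] (0:ℝ), (∀ k, wenoBeta f (y h) h k ≠ 0) ∧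
      wenoTau f (y h) h + wenoBetaBar f (y h) h ≠ 0 ∧
      (∑ j : Fin 3, alphaZCPlus p f (y h) h j) ≠ 0) ∧
    ∀ k, WExp (fun h => omegaZCPlus p f (y h) h k) (wenoD k)
      (wenoD k * ((B k - (1/10 * B 0 + 6/10 * B 1 + 3/10 * B 2)) / (2 * A))) := by
  obtain ⟨c1, c2⟩ := wcore p hp (fun h k => wenoBeta f (y h) h k / h ^ 4) A hA B hb
  have key : ∀ h : ℝ, 0 < h → ∀ k, alphaZCPlus p f (y h) h k
      = wAl p (fun k => wenoBeta f (y h) h k / h ^ 4) k := by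
    intro h hh k
    have : alphaZCPlus p f (y h) h k = wAl p (wenoBeta f (y h) h) k := rfl
    rw [this]
    refine wAl_scale p (h ^ 4) (by positivity) _ _ (fun k => ?_) k
    field_simp
  constructor
  · filter_upwards [c1, self_mem_nhdsWithin] with h hh hpos
    have hpos : 0 < h := hpos
    have h4 : 0 < h ^ 4 := by positivity
    have hbp : ∀ k, 0 < wenoBeta f (y h) h k := by
      intro k
      have := hh.1 k
      exact (div_pos_iff_of_pos_right h4).1 this
    refine ⟨fun k => (hbp k).ne', ?_, ?_⟩
    · have := hbp 0; have := hbp 1; have := hbp 2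
      unfold wenoTau wenoBetaBar
      positivity
    · simp only [key h hpos]
      exact hh.2.ne'
  · intro k
    refine (c2 k).congr ?_ rfl rfl
    filter_upwards [self_mem_nhdsWithin] with h hpos
    have hpos : 0 < h := hpos
    simp only [omegaZCPlus, key h hpos]

theorem WExp.bound {u : ℝ → ℝ} {c d : ℝ} (hu : WExp u c d) :
    ∃ C > (0:ℝ), ∀ᶠ h in 𝓝[>] (0:ℝ), |u h - (c + d * h)| ≤ C * h ^ 2 := by
  obtain ⟨C, hC, h⟩ := IsBigO.exists_pos hu
  refine ⟨C, hC, ?_⟩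
  filter_upwards [h.bound] with t ht
  simpa using ht

theorem wev {P : ℝ → Prop} (h : ∀ᶠ t in 𝓝[>] (0:ℝ), P t) :
    ∃ δ > (0:ℝ), ∀ t : ℝ, 0 < t → t < δ → P t := by
  obtain ⟨δ, hδ, hs⟩ := mem_nhdsGT_iff_exists_Ioo_subset.1 h
  exact ⟨δ, hδ, fun t h0 h1 => hs ⟨h0, h1⟩⟩

theorem wexact {u : ℝ → ℝ} {c d : ℝ} (hu : WExp u c d) (hd : d ≠ 0) :
    (∃ a > (0 : ℝ), ∃ C > (0 : ℝ), ∃ δ' > (0 : ℝ), ∀ t : ℝ, 0 < t → t < δ' →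
      a * t ≤ |u t - c| ∧ |u t - c| ≤ C * t) ∧
    ¬ (∃ C > (0 : ℝ), ∃ δ' > (0 : ℝ), ∀ t : ℝ, 0 < t → t < δ' → |u t - c| ≤ C * t ^ 3) := by
  have hd' : 0 < |d| := abs_pos.2 hd
  obtain ⟨C, hC, hb⟩ := hu.bound
  obtain ⟨δ, hδ, hb⟩ := wev hb
  have main : ∀ t : ℝ, 0 < t → t < min δ (|d| / (2 * C)) →
      |d| / 2 * t ≤ |u t - c| ∧ |u t - c| ≤ (3 * |d| / 2) * t := by
    intro t h0 ht
    have b1 := hb t h0 (ht.trans_le (min_le_left _ _))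
    have b2 := ht.trans_le (min_le_right _ _)
    rw [lt_div_iff₀ (by positivity)] at b2
    have b3 : C * t ^ 2 ≤ |d| / 2 * t := by nlinarith
    have e : |d * t| = |d| * t := by rw [abs_mul, abs_of_pos h0]
    have q1 : |u t - c| ≤ |u t - (c + d * t)| + |d * t| := by
      have := abs_add_le (u t - (c + d * t)) (d * t)
      rwa [show u t - (c + d * t) + d * t = u t - c by ring] at this
    have q2 : |d * t| ≤ |u t - (c + d * t)| + |u t - c| := by
      have := abs_sub (u t - c) (u t - (c + d * t))
      rw [show u t - c - (u t - (c + d * t)) = d * t by ring] at this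
      linarith
    constructor <;> nlinarith
  have hm : 0 < min δ (|d| / (2 * C)) := lt_min hδ (by positivity)
  refine ⟨⟨|d| / 2, by positivity, 3 * |d| / 2, by positivity, _, hm, main⟩, ?_⟩
  rintro ⟨K, hK, δ', hδ', hk⟩
  have h0 : Tendsto (fun t : ℝ => K * t ^ 2) (𝓝[>] (0:ℝ)) (𝓝 0) := by
    have : Tendsto (fun t : ℝ => K * t ^ 2) (𝓝 (0:ℝ)) (𝓝 (K * 0 ^ 2)) :=
      (by fun_prop : Continuous (fun t : ℝ => K * t ^ 2)).tendsto 0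
    simpa using this.mono_left nhdsWithin_le_nhds
  have l := h0.eventually_lt_const (show (0:ℝ) < |d| / 2 by positivity)
  have m1 : ∀ᶠ t in 𝓝[>] (0:ℝ), t ∈ Set.Ioo 0 (min (min δ (|d| / (2 * C))) δ') :=
    Ioo_mem_nhdsGT (lt_min hm hδ')
  obtain ⟨t, l, m1⟩ := (l.and m1).exists
  have a1 := (main t m1.1 (m1.2.trans_le (min_le_left _ _))).1
  have a2 := hk t m1.1 (m1.2.trans_le (min_le_right _ _))
  have := m1.1
  nlinarith

/-- at a first-order critical point (`f′(x) = 0`, `f″(x) ≠ 0`) and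
for `p ≥ 1`, the WENO-ZC+ weights are well defined for all sufficiently small
`Δx > 0` and satisfy
`ω_k^{ZC+,+} = d_k·[1 + (6/13)(C_k − 13/30)(f‴/f″)Δx + O(Δx²)]` and
`ω_k^{ZC+,−} = d_k·[1 + (6/25)(D_k + 11/2)(f‴/f″)Δx + O(Δx²)]` as `Δx → 0⁺`;
in particular, if `f‴(x) ≠ 0` then for `k = 0` and `k = 2` the deviation
`ω_k^{ZC+,+} − d_k` is of exact order `Δx`, so it is not `O(Δx³)`: the
WENO-ZC+ weights fail the fifth-order accuracy condition at first-order
critical points. -/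
theorem weno_zcplus_weights_first_order_critical_point
    (f : ℝ → ℝ) (hf : ContDiff ℝ (⊤ : ℕ∞) f) (x : ℝ)
    (h1 : deriv f x = 0) (h2 : iteratedDeriv 2 f x ≠ 0)
    (p : ℝ) (hp : 1 ≤ p) :
    ∃ δ > (0 : ℝ),
      (∀ Δx : ℝ, 0 < Δx → Δx < δ →
        (∀ k : Fin 3, wenoBeta f x Δx k ≠ 0) ∧
        (∀ k : Fin 3, wenoBeta f (x - Δx) Δx k ≠ 0) ∧
        wenoTau f x Δx + wenoBetaBar f x Δx ≠ 0 ∧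
        wenoTau f (x - Δx) Δx + wenoBetaBar f (x - Δx) Δx ≠ 0 ∧
        (∑ j : Fin 3, alphaZCPlus p f x Δx j) ≠ 0 ∧
        (∑ j : Fin 3, alphaZCPlus p f (x - Δx) Δx j) ≠ 0) ∧
      (∀ k : Fin 3, ∃ C > (0 : ℝ), ∀ Δx : ℝ, 0 < Δx → Δx < δ →
        |omegaZCPlus p f x Δx k -
          wenoD k * (1 + (6 / 13) * (wenoCC k - 13 / 30) *
            (iteratedDeriv 3 f x / iteratedDeriv 2 f x) * Δx)| ≤ C * Δx ^ 2 ∧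
        |omegaZCPlus p f (x - Δx) Δx k -
          wenoD k * (1 + (6 / 25) * (wenoDD k + 11 / 2) *
            (iteratedDeriv 3 f x / iteratedDeriv 2 f x) * Δx)| ≤ C * Δx ^ 2) ∧
      (iteratedDeriv 3 f x ≠ 0 →
        ∀ k : Fin 3, k = 0 ∨ k = 2 →
          (∃ c > (0 : ℝ), ∃ C > (0 : ℝ), ∃ δ' > (0 : ℝ), ∀ Δx : ℝ, 0 < Δx → Δx < δ' →
            c * Δx ≤ |omegaZCPlus p f x Δx k - wenoD k| ∧
            |omegaZCPlus p f x Δx k - wenoD k| ≤ C * Δx) ∧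
          ¬ (∃ C > (0 : ℝ), ∃ δ' > (0 : ℝ), ∀ Δx : ℝ, 0 < Δx → Δx < δ' →
            |omegaZCPlus p f x Δx k - wenoD k| ≤ C * Δx ^ 3)) := by
  set a := iteratedDeriv 2 f x with ha
  set b := iteratedDeriv 3 f x with hb
  have ha2 : 0 < a ^ 2 := by positivity
  obtain ⟨r1, r2⟩ := wmain p hp f (fun _ => x) _ (by positivity) _ (wright f hf x h1)
  obtain ⟨l1, l2⟩ := wmain p hp f (fun h => x - h) _ (by positivity) _ (wleft f hf x h1)
  have R : ∀ k, WExp (fun h => omegaZCPlus p f x h k) (wenoD k)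
      (wenoD k * ((6 / 13) * (wenoCC k - 13 / 30) * (b / a))) := by
    intro k
    refine (r2 k).congr (Eventually.of_forall fun _ => rfl) rfl ?_
    rw [← ha, ← hb]
    congr 1
    simp only [show wenoCC 0 = -13/6 from rfl, show wenoCC 1 = 0 from rfl,
      show wenoCC 2 = 13/6 from rfl]
    field_simp
    ring
  have L : ∀ k, WExp (fun h => omegaZCPlus p f (x - h) h k) (wenoD k)
      (wenoD k * ((6 / 25) * (wenoDD k + 11 / 2) * (b / a))) := by
    intro k
    refine (l2 k).congr (Eventually.of_forall fun _ => rfl) rfl ?_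
    rw [← ha, ← hb]
    congr 1
    simp only [show wenoDD 0 = -15/2 from rfl, show wenoDD 1 = -19/3 from rfl,
      show wenoDD 2 = -19/6 from rfl]
    field_simp
    ring
  choose C1 hC1 e1 using fun k => (R k).bound
  choose C2 hC2 e2 using fun k => (L k).bound
  obtain ⟨δ, hδ, H⟩ := wev (r1.and (l1.and ((eventually_all.2 e1).and (eventually_all.2 e2))))
  refine ⟨δ, hδ, ?_, ?_, ?_⟩
  · intro t h0 ht
    obtain ⟨⟨a1, a2, a3⟩, ⟨b1, b2, b3⟩, -⟩ := H t h0 ht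
    exact ⟨a1, b1, a2, b2, a3, b3⟩
  · intro k
    refine ⟨C1 k + C2 k, add_pos (hC1 k) (hC2 k), fun t h0 ht => ?_⟩
    obtain ⟨-, -, a1, a2⟩ := H t h0 ht
    have a1 := a1 k
    have a2 := a2 k
    have s : 0 ≤ t ^ 2 := by positivity
    have s1 := mul_nonneg (hC1 k).le s
    have s2 := mul_nonneg (hC2 k).le s
    constructor
    · calc _ = _ := by congr 2; ring
        _ ≤ _ := a1
        _ ≤ _ := by linarith
    · calc _ = _ := by congr 2; ring
        _ ≤ _ := a2
        _ ≤ _ := by linarith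
  · intro h3 k hk
    refine wexact (R k) ?_
    have hr : b / a ≠ 0 := div_ne_zero h3 h2
    rcases hk with rfl | rfl
    · simp only [wenoD, wenoCC]
      exact mul_ne_zero (by norm_num) (mul_ne_zero (by norm_num) hr)
    · simp only [wenoD, wenoCC]
      exact mul_ne_zero (by norm_num) (mul_ne_zero (by norm_num) hr)
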